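/- arXiv:2105.07162 — 3 statements merged into one kernel-verified Lean document; each statement's English description precedes it below -/
import Mathlib

section
/- Consider the quadratic function f(x) = ½xᵀAx − bᵀx on ℝⁿ with A symmetric positive definite, and the SR1 iteration: G₀ symmetric positive definite with A ⪯ G₀, x₀ ∈ ℝⁿ, x_{k+1} = x_k − G_k⁻¹∇f(x_k), u_k = x_{k+1} − x_k, G_{k+1} = SR1(A, G_k, u_k). If u_iᵀ(G_i − A)u_i > 0 for i = 0, …, k−1, then A u_i = G_k u_i for all i = 0, 1, …, k−1. -/
open Matrix

/-- The SR1 quasi-Newton update of `G` with respect to target `A` along direction `u`. -/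
noncomputable def SR1 {n : ℕ} (A G : Matrix (Fin n) (Fin n) ℝ) (u : Fin n → ℝ) :
    Matrix (Fin n) (Fin n) ℝ :=
  if (G - A) *ᵥ u = 0 then G
  else G - (u ⬝ᵥ ((G - A) *ᵥ u))⁻¹ • Matrix.vecMulVec ((G - A) *ᵥ u) ((G - A) *ᵥ u)
section SR1

variable {n : ℕ} {A G : Matrix (Fin n) (Fin n) ℝ} {u v : Fin n → ℝ}

theorem SR1_isSymm_sub (h : (G - A).IsSymm) : (SR1 A G u - A).IsSymm := by
  unfold SR1
  split_ifs
  · exact h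
  · rw [sub_right_comm]
    exact h.sub (Matrix.IsSymm.smul (Matrix.transpose_vecMulVec _ _) _)

theorem SR1_sub_mulVec (hu : (G - A) *ᵥ u ≠ 0) :
    (SR1 A G u - A) *ᵥ v = (G - A) *ᵥ v -
      ((u ⬝ᵥ ((G - A) *ᵥ u))⁻¹ * (((G - A) *ᵥ u) ⬝ᵥ v)) • ((G - A) *ᵥ u) := by
  rw [SR1, if_neg hu, sub_right_comm, Matrix.sub_mulVec (G - A), Matrix.smul_mulVec,
    Matrix.vecMulVec_mulVec, op_smul_eq_smul, smul_smul]

theorem SR1_sub_mulVec_self (hu : u ⬝ᵥ ((G - A) *ᵥ u) ≠ 0) :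
    (SR1 A G u - A) *ᵥ u = 0 := by
  have hu' : (G - A) *ᵥ u ≠ 0 := fun h => hu (by rw [h, dotProduct_zero])
  rw [SR1_sub_mulVec hu', dotProduct_comm ((G - A) *ᵥ u) u, inv_mul_cancel₀ hu, one_smul, sub_self]

/-- The SR1 update preserves earlier secant equations. -/
theorem SR1_sub_mulVec_eq_zero (h : (G - A).IsSymm) (hv : (G - A) *ᵥ v = 0) :
    (SR1 A G u - A) *ᵥ v = 0 := by
  by_cases hu : (G - A) *ᵥ u = 0
  · rwa [SR1, if_pos hu]
  · have hw : ((G - A) *ᵥ u) ⬝ᵥ v = 0 := by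
      rw [← Matrix.vecMul_transpose, h.eq, ← Matrix.dotProduct_mulVec, hv, dotProduct_zero]
    rw [SR1_sub_mulVec hu, hv, hw, mul_zero, zero_smul, sub_zero]

end SR1

/-- Lemma 3.3 (second part): if `u_iᵀ(G_i − A)u_i > 0` for i = 0,…,k−1, then
`A u_i = G_k u_i` for all i = 0,…,k−1. -/
theorem sr1_quadratic_secant_memory {n : ℕ}
    (A : Matrix (Fin n) (Fin n) ℝ) (b : Fin n → ℝ) (hA : A.PosDef)
    (x : ℕ → Fin n → ℝ) (G : ℕ → Matrix (Fin n) (Fin n) ℝ)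
    (hG0pd : (G 0).PosDef) (hG0 : (G 0 - A).PosSemidef)
    (hx : ∀ j, x (j+1) = x j - (G j)⁻¹ *ᵥ (A *ᵥ x j - b))
    (hGS : ∀ j, G (j+1) = SR1 A (G j) (x (j+1) - x j))
    (k : ℕ)
    (hpos : ∀ i < k, 0 < (x (i+1) - x i) ⬝ᵥ ((G i - A) *ᵥ (x (i+1) - x i))) :
    ∀ i < k, A *ᵥ (x (i+1) - x i) = G k *ᵥ (x (i+1) - x i) := by
  have hsymm : ∀ m, (G m - A).IsSymm := by
    intro m
    induction m with
    | zero => exact Matrix.isHermitian_iff_isSymm.mp hG0.isHermitian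
    | succ m ih => rw [hGS m]; exact SR1_isSymm_sub ih
  have key : ∀ m ≤ k, ∀ i < m, (G m - A) *ᵥ (x (i+1) - x i) = 0 := by
    intro m
    induction m with
    | zero => intro _ i hi; omega
    | succ m ih =>
      intro hm i hi
      rw [hGS m]
      rcases Nat.lt_succ_iff_lt_or_eq.mp hi with hlt | rfl
      · exact SR1_sub_mulVec_eq_zero (hsymm m) (ih (by omega) i hlt)
      · exact SR1_sub_mulVec_self (hpos i (by omega)).ne'
  intro i hi
  have h := key k le_rfl i hi
  rw [Matrix.sub_mulVec, sub_eq_zero] at h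
  exact h.symm
end

section
/- Consider the quadratic function f(x) = ½xᵀAx − bᵀx on ℝⁿ with A symmetric positive definite, and the SR1 iteration: G₀ symmetric positive definite with A ⪯ G₀, x₀ ∈ ℝⁿ, x_{k+1} = x_k − G_k⁻¹∇f(x_k), u_k = x_{k+1} − x_k, G_{k+1} = SR1(A, G_k, u_k). Let k ≥ 1 be the first index such that u_kᵀ(G_k − A)u_k = 0 (i.e., u_iᵀ(G_i − A)u_i > 0 for all i < k). Then ∇f(x_{k+1}) = 0, i.e., x_{k+1} is the minimizer of f. -/
open Matrix

/-- A symmetric matrix moves across the dot product. -/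
theorem Matrix.PosSemidef.dotProduct_mulVec_comm {n : ℕ} {R : Matrix (Fin n) (Fin n) ℝ}
    (hR : R.PosSemidef) (v w : Fin n → ℝ) : v ⬝ᵥ (R *ᵥ w) = w ⬝ᵥ (R *ᵥ v) := by
  have hT : Rᵀ = R := by simpa [Matrix.IsHermitian] using hR.isHermitian
  rw [Matrix.dotProduct_mulVec, ← Matrix.mulVec_transpose, hT, dotProduct_comm]

/-- Removing the rank-one part of a positive semidefinite matrix along `u` leaves a positive
semidefinite matrix. -/
theorem Matrix.PosSemidef.sub_rankOne {n : ℕ} {R : Matrix (Fin n) (Fin n) ℝ}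
    (hR : R.PosSemidef) (u : Fin n → ℝ) (hu : u ⬝ᵥ (R *ᵥ u) ≠ 0) :
    (R - (u ⬝ᵥ (R *ᵥ u))⁻¹ • Matrix.vecMulVec (R *ᵥ u) (R *ᵥ u)).PosSemidef := by
  refine Matrix.PosSemidef.of_dotProduct_mulVec_nonneg ?_ fun v => ?_
  · refine hR.isHermitian.sub ?_
    ext i j
    simp [Matrix.vecMulVec_apply, mul_comm]
  · set c := u ⬝ᵥ (R *ᵥ u) with hc
    set a := v ⬝ᵥ (R *ᵥ u) with ha
    have hcomm : u ⬝ᵥ (R *ᵥ v) = a := hR.dotProduct_mulVec_comm u v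
    have key := hR.dotProduct_mulVec_nonneg (v - (c⁻¹ * a) • u)
    simp only [star_trivial, Matrix.mulVec_sub, Matrix.mulVec_smul, dotProduct_sub,
      sub_dotProduct, dotProduct_smul, smul_dotProduct, smul_eq_mul, hcomm, ← ha, ← hc] at key
    have hvec : v ⬝ᵥ (Matrix.vecMulVec (R *ᵥ u) (R *ᵥ u) *ᵥ v) = a * a := by
      rw [Matrix.vecMulVec_mulVec, dotProduct_comm (R *ᵥ u) v]
      simp [← ha]
    simp only [star_trivial, Matrix.sub_mulVec, Matrix.smul_mulVec, dotProduct_sub,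
      dotProduct_smul, smul_eq_mul, hvec]
    convert key using 1
    field_simp
    ring

/-- The SR1 update preserves `A ⪯ G`. -/
theorem SR1_sub_posSemidef {n : ℕ} {A G : Matrix (Fin n) (Fin n) ℝ}
    (h : (G - A).PosSemidef) (u : Fin n → ℝ) : (SR1 A G u - A).PosSemidef := by
  unfold SR1
  split_ifs with hu
  · exact h
  · have hne : u ⬝ᵥ ((G - A) *ᵥ u) ≠ 0 := fun h0 =>
      hu ((h.dotProduct_mulVec_zero_iff u).1 (by simpa using h0))
    rw [sub_right_comm]
    exact h.sub_rankOne u hne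

/-- Theorem 3.1 (last claim): if `k ≥ 1` is the first index with
`u_kᵀ(G_k − A)u_k = 0`, then `x_{k+1}` is the minimizer of the quadratic,
i.e. `∇f(x_{k+1}) = A x_{k+1} − b = 0`. -/
theorem sr1_quadratic_termination {n : ℕ}
    (A : Matrix (Fin n) (Fin n) ℝ) (b : Fin n → ℝ) (hA : A.PosDef)
    (x : ℕ → Fin n → ℝ) (G : ℕ → Matrix (Fin n) (Fin n) ℝ)
    (hG0pd : (G 0).PosDef) (hG0 : (G 0 - A).PosSemidef)
    (hx : ∀ j, x (j+1) = x j - (G j)⁻¹ *ᵥ (A *ᵥ x j - b))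
    (hGS : ∀ j, G (j+1) = SR1 A (G j) (x (j+1) - x j))
    (k : ℕ) (hk : 1 ≤ k)
    (hzero : (x (k+1) - x k) ⬝ᵥ ((G k - A) *ᵥ (x (k+1) - x k)) = 0)
    (hpos : ∀ i < k, 0 < (x (i+1) - x i) ⬝ᵥ ((G i - A) *ᵥ (x (i+1) - x i))) :
    A *ᵥ x (k+1) - b = 0 := by
  have hR : ∀ j, (G j - A).PosSemidef := by
    intro j
    induction j with
    | zero => exact hG0
    | succ j ih => rw [hGS j]; exact SR1_sub_posSemidef ih _
  have hGk : (G k).PosDef := by simpa using hA.add_posSemidef (hR k)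
  have hRu : (G k - A) *ᵥ (x (k+1) - x k) = 0 :=
    ((hR k).dotProduct_mulVec_zero_iff _).1 (by simpa using hzero)
  have hstep : x (k+1) - x k = -((G k)⁻¹ *ᵥ (A *ᵥ x k - b)) := by
    rw [hx k]
    abel
  have hGu : G k *ᵥ (x (k+1) - x k) = -(A *ᵥ x k - b) := by
    rw [hstep, Matrix.mulVec_neg, Matrix.mulVec_mulVec,
      Matrix.mul_nonsing_inv _ ((Matrix.isUnit_iff_isUnit_det _).1 hGk.isUnit), Matrix.one_mulVec]
  rw [Matrix.sub_mulVec, hGu, Matrix.mulVec_sub, sub_eq_zero] at hRu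
  calc A *ᵥ x (k+1) - b = (A *ᵥ x (k+1) - A *ᵥ x k) + (A *ᵥ x k - b) := by abel
    _ = 0 := by rw [← hRu]; abel
end

section
/- Under the setup and hypotheses of the SR1_CS iteration with M·λ_f(x₀) ≤ ln(3/2)/(4κ) (f twice continuously differentiable, μI ⪯ ∇²f ⪯ LI, M-strongly self-concordant, G₀ = L·I, x_{k+1} = x_k − G_k⁻¹∇f(x_k), u_k = x_{k+1}−x_k, r_k = ‖u_k‖_{x_k}, G̃_k = (1+Mr_{k−1}/2)(1+Mr_k/2)G_k, J_k = ∫₀¹∇²f(x_k+tu_k)dt, G_{k+1} = SR1(J_k, G̃_k, u_k), κ = L/μ), it holds for every k ≥ 0 that J_k ⪯ G̃_k and G_k ⪯ 3κ·∇²f(x_k). -/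
open Matrix

/-- The Hessian matrix of `f` at `x`, with entries the second derivatives in the
standard basis directions. -/
noncomputable def hess {n : ℕ} (f : (Fin n → ℝ) → ℝ) (x : Fin n → ℝ) :
    Matrix (Fin n) (Fin n) ℝ :=
  Matrix.of fun i j => iteratedFDeriv ℝ 2 f x ![Pi.single i 1, Pi.single j 1]

/-- The gradient of `f` at `x`. -/
noncomputable def grad {n : ℕ} (f : (Fin n → ℝ) → ℝ) (x : Fin n → ℝ) : Fin n → ℝ :=
  fun i => fderiv ℝ f x (Pi.single i 1)

/-- The local norm `‖v‖_z = √(vᵀ ∇²f(z) v)`. -/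
noncomputable def znorm {n : ℕ} (f : (Fin n → ℝ) → ℝ) (z v : Fin n → ℝ) : ℝ :=
  Real.sqrt (v ⬝ᵥ (hess f z *ᵥ v))

/-- The local gradient norm `λ_f(x) = √(∇f(x)ᵀ [∇²f(x)]⁻¹ ∇f(x))`. -/
noncomputable def lamG {n : ℕ} (f : (Fin n → ℝ) → ℝ) (x : Fin n → ℝ) : ℝ :=
  Real.sqrt (grad f x ⬝ᵥ ((hess f x)⁻¹ *ᵥ grad f x))

/-- `f` is `M`-strongly self-concordant:
`∇²f(y) − ∇²f(x) ⪯ M‖y−x‖_z ∇²f(w)` for all `x, y, z, w`. -/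
def StrongSelfConcordant {n : ℕ} (f : (Fin n → ℝ) → ℝ) (M : ℝ) : Prop :=
  ∀ x y z w : Fin n → ℝ,
    ((M * znorm f z (y - x)) • hess f w - (hess f y - hess f x)).PosSemidef

/-- The averaged Hessian `J_k = ∫₀¹ ∇²f(x_k + t u_k) dt` (entrywise integral),
where `u_k = x_{k+1} − x_k`. -/
noncomputable def Jmat {n : ℕ} (f : (Fin n → ℝ) → ℝ) (x : ℕ → Fin n → ℝ) (k : ℕ) :
    Matrix (Fin n) (Fin n) ℝ :=
  Matrix.of fun i j => ∫ t in (0:ℝ)..(1:ℝ), hess f (x k + t • (x (k+1) - x k)) i j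

section LinearAlgebra

variable {n : ℕ} {A B : Matrix (Fin n) (Fin n) ℝ}

theorem Matrix.IsHermitian.dotProduct_mulVec_symm (hA : A.IsHermitian) (u v : Fin n → ℝ) :
    u ⬝ᵥ A *ᵥ v = v ⬝ᵥ A *ᵥ u := by
  have hT : Aᵀ = A := by simpa [conjTranspose_eq_transpose_of_trivial] using hA.eq
  rw [dotProduct_mulVec, ← mulVec_transpose, hT, dotProduct_comm]

theorem Matrix.PosSemidef.quad_nonneg (hA : A.PosSemidef) (v : Fin n → ℝ) :
    0 ≤ v ⬝ᵥ A *ᵥ v := by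
  simpa using hA.dotProduct_mulVec_nonneg v

theorem Matrix.PosSemidef.quad_le (h : (B - A).PosSemidef) (v : Fin n → ℝ) :
    v ⬝ᵥ A *ᵥ v ≤ v ⬝ᵥ B *ᵥ v := by
  simpa [sub_mulVec, dotProduct_sub] using h.quad_nonneg v

theorem Matrix.posSemidef_sub_of_quad_le (hA : A.IsHermitian) (hB : B.IsHermitian)
    (h : ∀ v, v ⬝ᵥ A *ᵥ v ≤ v ⬝ᵥ B *ᵥ v) : (B - A).PosSemidef :=
  .of_dotProduct_mulVec_nonneg (hB.sub hA) fun v => by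
    simpa [sub_mulVec, dotProduct_sub] using h v

theorem Matrix.quad_smul (c : ℝ) (v : Fin n → ℝ) :
    v ⬝ᵥ (c • A) *ᵥ v = c * (v ⬝ᵥ A *ᵥ v) := by
  simp [smul_mulVec, dotProduct_smul]

/-- A symmetric form dominated by a positive semidefinite one on the diagonal is dominated off the
diagonal as well. -/
theorem Matrix.sq_dotProduct_mulVec_le {Q N : Matrix (Fin n) (Fin n) ℝ} (hQ : Q.IsHermitian)
    (hN : N.IsHermitian) {m : ℝ}
    (hle : ∀ v, v ⬝ᵥ Q *ᵥ v ≤ m * (v ⬝ᵥ N *ᵥ v)) (hge : ∀ v, -(m * (v ⬝ᵥ N *ᵥ v)) ≤ v ⬝ᵥ Q *ᵥ v)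
    (u v : Fin n → ℝ) :
    (u ⬝ᵥ Q *ᵥ v) ^ 2 ≤ m ^ 2 * (u ⬝ᵥ N *ᵥ u) * (v ⬝ᵥ N *ᵥ v) := by
  have key : ∀ t : ℝ, 0 ≤ (m * (v ⬝ᵥ N *ᵥ v)) * (t * t) + (2 * (u ⬝ᵥ Q *ᵥ v)) * t +
      m * (u ⬝ᵥ N *ᵥ u) := by
    intro t
    have h₁ := hge (u + t • v)
    have h₂ := hle (u - t • v)
    simp only [mulVec_add, mulVec_sub, mulVec_smul, dotProduct_add, add_dotProduct, smul_dotProduct,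
      dotProduct_smul, dotProduct_sub, sub_dotProduct, smul_eq_mul] at h₁ h₂
    rw [hQ.dotProduct_mulVec_symm v u, hN.dotProduct_mulVec_symm v u] at h₁ h₂
    linarith
  have := discrim_le_zero key
  rw [discrim] at this
  linarith

theorem Matrix.PosSemidef.cauchySchwarz (hA : A.PosSemidef) (u v : Fin n → ℝ) :
    (u ⬝ᵥ A *ᵥ v) ^ 2 ≤ (u ⬝ᵥ A *ᵥ u) * (v ⬝ᵥ A *ᵥ v) := by
  have := sq_dotProduct_mulVec_le hA.isHermitian hA.isHermitian (m := 1) (by simp)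
    (fun w => by linarith [hA.quad_nonneg w]) u v
  simpa using this

theorem Matrix.PosDef.mulVec_inv_mulVec (hA : A.PosDef) (v : Fin n → ℝ) :
    A *ᵥ (A⁻¹ *ᵥ v) = v := by
  rw [mulVec_mulVec, mul_nonsing_inv _ ((isUnit_iff_isUnit_det A).1 hA.isUnit), one_mulVec]

theorem Matrix.PosDef.quad_inv_le (hA : A.PosDef) (hB : B.PosDef) {c : ℝ}
    (h : ∀ v, v ⬝ᵥ B *ᵥ v ≤ c * (v ⬝ᵥ A *ᵥ v)) (g : Fin n → ℝ) :
    g ⬝ᵥ A⁻¹ *ᵥ g ≤ c * (g ⬝ᵥ B⁻¹ *ᵥ g) := by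
  set w := A⁻¹ *ᵥ g
  set z := B⁻¹ *ᵥ g
  have hAw : A *ᵥ w = g := hA.mulVec_inv_mulVec g
  have hBz : B *ᵥ z = g := hB.mulVec_inv_mulVec g
  have hcs := hB.posSemidef.cauchySchwarz w z
  have hw := h w
  have h₀ : 0 ≤ w ⬝ᵥ g := by simpa [hAw] using hA.posSemidef.quad_nonneg w
  have h₁ : 0 ≤ z ⬝ᵥ g := by simpa [hBz] using hB.posSemidef.quad_nonneg z
  rw [hBz] at hcs
  rw [hAw] at hw
  rw [dotProduct_comm g w, dotProduct_comm g z]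
  rcases h₀.eq_or_lt with h₀ | h₀
  · have hg : g = 0 := by
      by_contra hg
      have hw0 : w ≠ 0 := fun h => hg (by rw [← hAw, h, mulVec_zero])
      have := hA.dotProduct_mulVec_pos hw0
      simp [hAw, ← h₀] at this
    simp [hg]
  · have := mul_le_mul_of_nonneg_right hw h₁
    nlinarith

/-- One quasi-Newton step contracts the local gradient norm. -/
theorem quad_inv_residual_le {J G H H' : Matrix (Fin n) (Fin n) ℝ} (hJ : J.PosDef) (hG : G.PosDef)
    (hH : H.PosDef) (hH' : H'.PosDef) {m b : ℝ} (hb : 0 ≤ b) (hm : m < 1)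
    (hJG : ∀ v, v ⬝ᵥ J *ᵥ v ≤ (1 + m) * (v ⬝ᵥ G *ᵥ v))
    (hGJ : ∀ v, v ⬝ᵥ G *ᵥ v ≤ (1 - m)⁻¹ * (v ⬝ᵥ J *ᵥ v))
    (hHJ : ∀ v, v ⬝ᵥ H *ᵥ v ≤ b * (v ⬝ᵥ J *ᵥ v))
    (hJH : ∀ v, v ⬝ᵥ J *ᵥ v ≤ b * (v ⬝ᵥ H' *ᵥ v)) {g g' : Fin n → ℝ}
    (hg' : g' = g - J *ᵥ (G⁻¹ *ᵥ g)) :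
    g' ⬝ᵥ H'⁻¹ *ᵥ g' ≤ (m * b) ^ 2 * (g ⬝ᵥ H⁻¹ *ᵥ g) := by
  have e₁ := hG.quad_inv_le hJ hJG
  have e₂ := hJ.quad_inv_le hG hGJ
  have e₃ := hJ.quad_inv_le hH hHJ g
  set w := H'⁻¹ *ᵥ g' with hw
  have hHw : H' *ᵥ w = g' := hH'.mulVec_inv_mulVec g'
  have e₄ := hJH w
  rw [hHw] at e₄
  have hinv : J⁻¹ *ᵥ (J *ᵥ w) = w := by
    rw [mulVec_mulVec, nonsing_inv_mul _ ((isUnit_iff_isUnit_det J).1 hJ.isUnit), one_mulVec]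
  have hcs := sq_dotProduct_mulVec_le (Q := J⁻¹ - G⁻¹) (N := J⁻¹)
    (hJ.inv.isHermitian.sub hG.inv.isHermitian) hJ.inv.isHermitian (m := m)
    (fun v => by
      have h := e₂ v
      rw [inv_mul_eq_div, le_div_iff₀ (by linarith)] at h
      rw [sub_mulVec, dotProduct_sub]
      linarith)
    (fun v => by
      rw [sub_mulVec, dotProduct_sub]
      linarith [e₁ v]) (J *ᵥ w) g
  have hpair : (J *ᵥ w) ⬝ᵥ (J⁻¹ - G⁻¹) *ᵥ g = w ⬝ᵥ g' := by
    rw [dotProduct_comm, hJ.isHermitian.dotProduct_mulVec_symm _ w, sub_mulVec, mulVec_sub,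
      hJ.mulVec_inv_mulVec, hg']
  rw [hpair, hinv, dotProduct_comm (J *ᵥ w) w] at hcs
  have hN : 0 ≤ g ⬝ᵥ H⁻¹ *ᵥ g := hH.inv.posSemidef.quad_nonneg g
  have hNJ : 0 ≤ g ⬝ᵥ J⁻¹ *ᵥ g := hJ.inv.posSemidef.quad_nonneg g
  have h₀ : 0 ≤ w ⬝ᵥ g' := by
    simpa [hHw] using hH'.posSemidef.quad_nonneg w
  rw [dotProduct_comm g' w]
  have hprod : (w ⬝ᵥ J *ᵥ w) * (g ⬝ᵥ J⁻¹ *ᵥ g) ≤ (b * (w ⬝ᵥ g')) * (b * (g ⬝ᵥ H⁻¹ *ᵥ g)) :=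
    mul_le_mul e₄ e₃ hNJ (mul_nonneg hb h₀)
  have htot : (w ⬝ᵥ g') * (w ⬝ᵥ g') ≤ ((m * b) ^ 2 * (g ⬝ᵥ H⁻¹ *ᵥ g)) * (w ⬝ᵥ g') := by
    nlinarith [mul_le_mul_of_nonneg_left hprod (sq_nonneg m)]
  rcases h₀.eq_or_lt with h₀ | h₀
  · rw [← h₀]; positivity
  · exact le_of_mul_le_mul_right htot h₀

theorem SR1_quad {u : Fin n → ℝ} (v : Fin n → ℝ) :
    v ⬝ᵥ SR1 A B u *ᵥ v =
      v ⬝ᵥ B *ᵥ v - (u ⬝ᵥ (B - A) *ᵥ u)⁻¹ * (v ⬝ᵥ (B - A) *ᵥ u) ^ 2 := by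
  unfold SR1
  split_ifs with h
  · simp [h]
  · simp only [sub_mulVec B, dotProduct_sub v, smul_mulVec, dotProduct_smul, vecMulVec_mulVec,
      op_smul_eq_smul, smul_eq_mul, dotProduct_comm _ v]
    ring

theorem SR1_isHermitian (hB : B.IsHermitian) (u : Fin n → ℝ) : (SR1 A B u).IsHermitian := by
  unfold SR1
  split_ifs
  · exact hB
  · refine hB.sub ?_
    ext i j
    simp [vecMulVec_apply, mul_comm]

theorem SR1_quad_le (h : (B - A).PosSemidef) (u v : Fin n → ℝ) :
    v ⬝ᵥ SR1 A B u *ᵥ v ≤ v ⬝ᵥ B *ᵥ v := by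
  rw [SR1_quad]
  have := mul_nonneg (inv_nonneg.2 (h.quad_nonneg u)) (sq_nonneg (v ⬝ᵥ (B - A) *ᵥ u))
  linarith

theorem le_SR1_quad (h : (B - A).PosSemidef) (u v : Fin n → ℝ) :
    v ⬝ᵥ A *ᵥ v ≤ v ⬝ᵥ SR1 A B u *ᵥ v := by
  rw [SR1_quad]
  have hcs := h.cauchySchwarz v u
  have hu := h.quad_nonneg u
  have hv := h.quad_nonneg v
  have key : (u ⬝ᵥ (B - A) *ᵥ u)⁻¹ * (v ⬝ᵥ (B - A) *ᵥ u) ^ 2 ≤ v ⬝ᵥ (B - A) *ᵥ v := by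
    rw [inv_mul_eq_div]
    exact div_le_of_le_mul₀ hu hv hcs
  rw [sub_mulVec B A v, dotProduct_sub] at key
  linarith

theorem Matrix.PosDef.of_quad_ge {μ : ℝ} (hμ : 0 < μ) (hA : A.IsHermitian)
    (h : ∀ v, μ * (v ⬝ᵥ v) ≤ v ⬝ᵥ A *ᵥ v) : A.PosDef :=
  .of_dotProduct_mulVec_pos hA fun v hv => by
    have : 0 < v ⬝ᵥ v := by
      simpa using dotProduct_star_self_pos_iff.2 hv
    simpa using (mul_pos hμ this).trans_le (h v)

end LinearAlgebra

section Analysis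

/-- If the increments of `φ` are controlled by every value of `φ`, then the average of `φ` is
comparable to its value at the left endpoint. -/
theorem average_comparable_left {φ : ℝ → ℝ} (hφ : Continuous φ) {C : ℝ}
    (h : ∀ s ∈ Set.Icc (0 : ℝ) 1, ∀ t ∈ Set.Icc (0 : ℝ) 1, ∀ w,
      φ t - φ s ≤ C * |t - s| * φ w) :
    ∫ t in (0 : ℝ)..1, φ t ≤ (1 + C / 2) * φ 0 ∧
      φ 0 ≤ (1 + C / 2) * ∫ t in (0 : ℝ)..1, φ t := by
  have h0 : (0 : ℝ) ∈ Set.Icc (0 : ℝ) 1 := by simp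
  have hlin : ∀ a c : ℝ, ∫ t in (0 : ℝ)..1, (a + t * c) = a + c / 2 := by
    intro a c
    rw [intervalIntegral.integral_add (by simp) (Continuous.intervalIntegrable (by fun_prop) _ _),
      intervalIntegral.integral_mul_const, integral_id]
    simp
    ring
  constructor
  · calc ∫ t in (0 : ℝ)..1, φ t ≤ ∫ t in (0 : ℝ)..1, (φ 0 + t * (C * φ 0)) := by
          refine intervalIntegral.integral_mono_on zero_le_one (hφ.intervalIntegrable _ _)
            (Continuous.intervalIntegrable (by fun_prop) _ _) fun t ht => ?_
          have := h 0 h0 t ht 0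
          rw [sub_zero, abs_of_nonneg ht.1] at this
          linarith
      _ = (1 + C / 2) * φ 0 := by rw [hlin]; ring
  · set I := ∫ t in (0 : ℝ)..1, φ t with hI
    have step : ∀ t ∈ Set.Icc (0 : ℝ) 1, φ 0 - φ t ≤ C * t * I := by
      intro t ht
      have hm : ∫ _ in (0 : ℝ)..1, (φ 0 - φ t) ≤ ∫ w in (0 : ℝ)..1, C * t * φ w := by
        refine intervalIntegral.integral_mono_on zero_le_one (by simp)
          (Continuous.intervalIntegrable (by fun_prop) _ _) fun w _ => ?_
        have := h t ht 0 h0 w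
        rwa [zero_sub, abs_neg, abs_of_nonneg ht.1] at this
      rw [intervalIntegral.integral_const_mul, ← hI] at hm
      simpa using hm
    have : ∫ t in (0 : ℝ)..1, (φ 0 + t * (-(C * I))) ≤ I := by
      refine intervalIntegral.integral_mono_on zero_le_one
        (Continuous.intervalIntegrable (by fun_prop) _ _) (hφ.intervalIntegrable _ _) fun t ht => ?_
      have := step t ht
      linarith
    rw [hlin] at this
    linarith

theorem average_comparable_right {φ : ℝ → ℝ} (hφ : Continuous φ) {C : ℝ}
    (h : ∀ s ∈ Set.Icc (0 : ℝ) 1, ∀ t ∈ Set.Icc (0 : ℝ) 1, ∀ w,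
      φ t - φ s ≤ C * |t - s| * φ w) :
    ∫ t in (0 : ℝ)..1, φ t ≤ (1 + C / 2) * φ 1 ∧
      φ 1 ≤ (1 + C / 2) * ∫ t in (0 : ℝ)..1, φ t := by
  have key := average_comparable_left (φ := fun t => φ (1 - t)) (by fun_prop) (C := C)
    fun s hs t ht w => by
      have := h (1 - s) ⟨by linarith [hs.2], by linarith [hs.1]⟩ (1 - t)
        ⟨by linarith [ht.2], by linarith [ht.1]⟩ (1 - w)
      rwa [show (1 - t - (1 - s)) = -(t - s) by ring, abs_neg] at this
  simpa [intervalIntegral.integral_comp_sub_left] using key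

variable {n : ℕ} {f : (Fin n → ℝ) → ℝ}

theorem continuous_hess_apply (hf : ContDiff ℝ 2 f) (i j : Fin n) :
    Continuous fun y => hess f y i j := by
  have h := hf.continuous_iteratedFDeriv (m := 2) le_rfl
  simp only [hess, of_apply]
  fun_prop

theorem continuous_hess_quad (hf : ContDiff ℝ 2 f) (v : Fin n → ℝ) :
    Continuous fun y => v ⬝ᵥ hess f y *ᵥ v := by
  have h := continuous_hess_apply hf
  simp only [dotProduct, mulVec]
  fun_prop

theorem Jmat_mulVec (hf : ContDiff ℝ 2 f) (x : ℕ → Fin n → ℝ) (k : ℕ) (v : Fin n → ℝ)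
    (i : Fin n) :
    (Jmat f x k *ᵥ v) i =
      ∫ t in (0 : ℝ)..1, (hess f (x k + t • (x (k + 1) - x k)) *ᵥ v) i := by
  have h := continuous_hess_apply hf
  simp only [mulVec, dotProduct, Jmat, of_apply]
  rw [intervalIntegral.integral_finsetSum]
  · simp
  · intro j _
    exact Continuous.intervalIntegrable (by fun_prop) _ _

theorem Jmat_quad (hf : ContDiff ℝ 2 f) (x : ℕ → Fin n → ℝ) (k : ℕ) (v : Fin n → ℝ) :
    v ⬝ᵥ Jmat f x k *ᵥ v =
      ∫ t in (0 : ℝ)..1, v ⬝ᵥ hess f (x k + t • (x (k + 1) - x k)) *ᵥ v := by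
  have h := continuous_hess_apply hf
  simp only [dotProduct]
  rw [intervalIntegral.integral_finsetSum]
  · simp [Jmat_mulVec hf]
  · intro j _
    simp only [mulVec, dotProduct]
    exact Continuous.intervalIntegrable (by fun_prop) _ _

theorem Jmat_isHermitian (hH : ∀ y, (hess f y).IsHermitian) (x : ℕ → Fin n → ℝ) (k : ℕ) :
    (Jmat f x k).IsHermitian := by
  ext i j
  simp only [Jmat, conjTranspose_apply, of_apply, star_trivial]
  congr! 2 with t
  simpa using (hH _).apply i j

theorem hess_mulVec (hH : ∀ y, (hess f y).IsHermitian) (y v : Fin n → ℝ) (i : Fin n) :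
    (hess f y *ᵥ v) i = fderiv ℝ (fderiv ℝ f) y v (Pi.single i 1) := by
  conv_rhs => rw [pi_eq_sum_univ' v]
  simp only [map_sum, map_smul, _root_.sum_apply, _root_.smul_apply,
    mulVec, dotProduct, smul_eq_mul]
  refine Finset.sum_congr rfl fun j _ => ?_
  have : hess f y i j = hess f y j i := by simpa using ((hH y).apply i j).symm
  rw [this, mul_comm]
  simp [hess, iteratedFDeriv_two_apply]

theorem Jmat_mulVec_step (hf : ContDiff ℝ 2 f) (hH : ∀ y, (hess f y).IsHermitian)
    (x : ℕ → Fin n → ℝ) (k : ℕ) :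
    Jmat f x k *ᵥ (x (k + 1) - x k) = grad f (x (k + 1)) - grad f (x k) := by
  ext i
  rw [Jmat_mulVec hf]
  set u := x (k + 1) - x k with hu
  have hc := continuous_hess_apply hf
  have hd : ∀ t : ℝ, HasDerivAt (fun t : ℝ => fderiv ℝ f (x k + t • u) (Pi.single i 1))
      ((hess f (x k + t • u) *ᵥ u) i) t := by
    intro t
    rw [hess_mulVec hH]
    have h₁ : HasFDerivAt (fderiv ℝ f) (fderiv ℝ (fderiv ℝ f) (x k + t • u)) (x k + t • u) :=
      (((hf.fderiv_right (m := 1) (by norm_num)).differentiable (by norm_num)) _).hasFDerivAt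
    have h₂ : HasDerivAt (fun t : ℝ => x k + t • u) u t := by
      simpa using ((hasDerivAt_id t).smul_const u).const_add (x k)
    have h₃ := h₁.comp_hasDerivAt t h₂
    simpa using h₃.clm_apply (hasDerivAt_const t (Pi.single i (1 : ℝ)))
  rw [intervalIntegral.integral_eq_sub_of_hasDerivAt (fun t _ => hd t)]
  · simp [grad, hu]
  · simp only [mulVec, dotProduct]
    exact Continuous.intervalIntegrable (by fun_prop) _ _

theorem znorm_smul (z v : Fin n → ℝ) (c : ℝ) : znorm f z (c • v) = |c| * znorm f z v := by
  unfold znorm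
  rw [mulVec_smul, dotProduct_smul, smul_dotProduct, smul_eq_mul, smul_eq_mul, ← mul_assoc,
    Real.sqrt_mul (mul_self_nonneg c), Real.sqrt_mul_self_eq_abs]

theorem StrongSelfConcordant.segment {M : ℝ} (hssc : StrongSelfConcordant f M)
    (p u v : Fin n → ℝ) (s t w : ℝ) :
    v ⬝ᵥ hess f (p + t • u) *ᵥ v - v ⬝ᵥ hess f (p + s • u) *ᵥ v ≤
      M * znorm f p u * |t - s| * (v ⬝ᵥ hess f (p + w • u) *ᵥ v) := by
  have h := (hssc (p + s • u) (p + t • u) p (p + w • u)).quad_le v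
  rw [quad_smul, sub_mulVec, dotProduct_sub,
    show p + t • u - (p + s • u) = (t - s) • u by rw [sub_smul]; abel, znorm_smul] at h
  linarith

theorem Jmat_comparable {M : ℝ} (hf : ContDiff ℝ 2 f) (hssc : StrongSelfConcordant f M)
    (x : ℕ → Fin n → ℝ) (k : ℕ) (v : Fin n → ℝ) :
    let b := 1 + M * znorm f (x k) (x (k + 1) - x k) / 2
    (v ⬝ᵥ Jmat f x k *ᵥ v ≤ b * (v ⬝ᵥ hess f (x k) *ᵥ v) ∧
      v ⬝ᵥ hess f (x k) *ᵥ v ≤ b * (v ⬝ᵥ Jmat f x k *ᵥ v)) ∧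
    (v ⬝ᵥ Jmat f x k *ᵥ v ≤ b * (v ⬝ᵥ hess f (x (k + 1)) *ᵥ v) ∧
      v ⬝ᵥ hess f (x (k + 1)) *ᵥ v ≤ b * (v ⬝ᵥ Jmat f x k *ᵥ v)) := by
  intro b
  set φ : ℝ → ℝ := fun t => v ⬝ᵥ hess f (x k + t • (x (k + 1) - x k)) *ᵥ v with hφ
  have hc : Continuous φ := (continuous_hess_quad hf v).comp
    (by fun_prop : Continuous fun t : ℝ => x k + t • (x (k + 1) - x k))
  have h := fun s (_ : s ∈ Set.Icc (0 : ℝ) 1) t (_ : t ∈ Set.Icc (0 : ℝ) 1) w =>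
    hssc.segment (x k) (x (k + 1) - x k) v s t w
  have h₀ := average_comparable_left hc h
  have h₁ := average_comparable_right hc h
  rw [← Jmat_quad hf] at h₀ h₁
  simp only [hφ, zero_smul, add_zero, one_smul, add_sub_cancel] at h₀ h₁
  exact ⟨h₀, h₁⟩

end Analysis

section Iteration

variable {n : ℕ} {f : (Fin n → ℝ) → ℝ}

theorem znorm_newton_step_le {G : Matrix (Fin n) (Fin n) ℝ} {p : Fin n → ℝ} {a : ℝ}
    (hH : (hess f p).PosDef) (hG : G.PosDef) (ha : 0 ≤ a)
    (h : ∀ v, v ⬝ᵥ hess f p *ᵥ v ≤ a * (v ⬝ᵥ G *ᵥ v)) :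
    znorm f p (-(G⁻¹ *ᵥ grad f p)) ≤ a * lamG f p := by
  unfold znorm lamG
  have h₁ := h (G⁻¹ *ᵥ grad f p)
  rw [hG.mulVec_inv_mulVec, dotProduct_comm _ (grad f p)] at h₁
  have h₂ := mul_le_mul_of_nonneg_left (hG.quad_inv_le hH h (grad f p)) ha
  rw [mulVec_neg, neg_dotProduct, dotProduct_neg, neg_neg]
  refine Real.sqrt_le_iff.2 ⟨by positivity, ?_⟩
  rw [mul_pow, Real.sq_sqrt (hH.inv.posSemidef.quad_nonneg _)]
  linarith

theorem lamG_newton_step_le {J G : Matrix (Fin n) (Fin n) ℝ} {p p' : Fin n → ℝ} {m b : ℝ}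
    (hJ : J.PosDef) (hG : G.PosDef) (hH : (hess f p).PosDef) (hH' : (hess f p').PosDef)
    (hb : 0 ≤ b) (hm₀ : 0 ≤ m) (hm : m < 1)
    (hJG : ∀ v, v ⬝ᵥ J *ᵥ v ≤ (1 + m) * (v ⬝ᵥ G *ᵥ v))
    (hGJ : ∀ v, v ⬝ᵥ G *ᵥ v ≤ (1 - m)⁻¹ * (v ⬝ᵥ J *ᵥ v))
    (hHJ : ∀ v, v ⬝ᵥ hess f p *ᵥ v ≤ b * (v ⬝ᵥ J *ᵥ v))
    (hJH : ∀ v, v ⬝ᵥ J *ᵥ v ≤ b * (v ⬝ᵥ hess f p' *ᵥ v))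
    (hg : grad f p' = grad f p - J *ᵥ (G⁻¹ *ᵥ grad f p)) :
    lamG f p' ≤ m * b * lamG f p := by
  unfold lamG
  refine Real.sqrt_le_iff.2 ⟨by positivity, ?_⟩
  rw [mul_pow, Real.sq_sqrt (hH.inv.posSemidef.quad_nonneg _)]
  exact quad_inv_residual_le hJ hG hH hH' hb hm hJG hGJ hHJ hJH hg

/-- The quantities propagated along the iteration: `a` is the correction factor coming from the
previous step and `l` the scaled local gradient norm. -/
structure CorrectedState (κ L a l : ℝ) (H G : Matrix (Fin n) (Fin n) ℝ) : Prop where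
  posDef : G.PosDef
  one_le : 1 ≤ a
  le_one_add : κ * (a - 1) ≤ 9 / 128
  local_le : κ * l ≤ 1 / 8
  hess_le : ∀ v, v ⬝ᵥ H *ᵥ v ≤ a * (v ⬝ᵥ G *ᵥ v)
  le_smul_one : ∀ v, a * (v ⬝ᵥ G *ᵥ v) ≤
    Real.exp (9 / 32 - 9 / 4 * (κ * l)) * L * (v ⬝ᵥ v)

theorem CorrectedState.quad_le {κ μ L a l : ℝ} {H G : Matrix (Fin n) (Fin n) ℝ}
    (h : CorrectedState κ L a l H G) (hκ : κ = L / μ) (hμ : 0 < μ) (hL : 0 ≤ L) (hl : 0 ≤ l)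
    (hlow : ∀ v, μ * (v ⬝ᵥ v) ≤ v ⬝ᵥ H *ᵥ v) (v : Fin n → ℝ) :
    v ⬝ᵥ G *ᵥ v ≤ 3 / 2 * κ * (v ⬝ᵥ H *ᵥ v) := by
  have hκ₀ : 0 ≤ κ := hκ ▸ by positivity
  have hexp : Real.exp (9 / 32 - 9 / 4 * (κ * l)) ≤ 3 / 2 := by
    have h₁ : Real.exp (9 / 32 - 9 / 4 * (κ * l)) ≤ Real.exp (9 / 32) :=
      Real.exp_le_exp.2 (by nlinarith [mul_nonneg hκ₀ hl])
    have h₂ := Real.add_one_le_exp (-(9 / 32 : ℝ))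
    have h₃ : Real.exp (-(9 / 32)) * Real.exp (9 / 32) = 1 := by rw [← Real.exp_add]; simp
    nlinarith [Real.exp_pos (9 / 32)]
  have hv : 0 ≤ v ⬝ᵥ v := by simpa using dotProduct_star_self_nonneg v
  have hG := h.posDef.posSemidef.quad_nonneg v
  have hLκ : L = κ * μ := by rw [hκ]; field_simp
  calc v ⬝ᵥ G *ᵥ v ≤ a * (v ⬝ᵥ G *ᵥ v) := le_mul_of_one_le_left hG h.one_le
    _ ≤ Real.exp (9 / 32 - 9 / 4 * (κ * l)) * L * (v ⬝ᵥ v) := h.le_smul_one v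
    _ ≤ 3 / 2 * L * (v ⬝ᵥ v) := by gcongr
    _ = 3 / 2 * κ * (μ * (v ⬝ᵥ v)) := by rw [hLκ]; ring
    _ ≤ 3 / 2 * κ * (v ⬝ᵥ H *ᵥ v) := by gcongr; exact hlow v

theorem CorrectedState.step {κ μ L M a : ℝ} (hκ : κ = L / μ) (hf : ContDiff ℝ 2 f)
    (hμ : 0 < μ) (hμL : μ ≤ L) (hM : 0 ≤ M) (hH : ∀ y, (hess f y).PosDef)
    (hlow : ∀ y v, μ * (v ⬝ᵥ v) ≤ v ⬝ᵥ hess f y *ᵥ v)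
    (hssc : StrongSelfConcordant f M) {x : ℕ → Fin n → ℝ} {k : ℕ}
    {G : Matrix (Fin n) (Fin n) ℝ}
    (h : CorrectedState κ L a (M * lamG f (x k)) (hess f (x k)) G)
    (hx : x (k + 1) = x k - G⁻¹ *ᵥ grad f (x k)) {b : ℝ}
    (hb : b = 1 + M * znorm f (x k) (x (k + 1) - x k) / 2) :
    ((a * b) • G - Jmat f x k).PosSemidef ∧
      CorrectedState κ L b (M * lamG f (x (k + 1))) (hess f (x (k + 1)))
        (SR1 (Jmat f x k) ((a * b) • G) (x (k + 1) - x k)) := by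
  have hL : 0 < L := hμ.trans_le hμL
  have hκ₁ : 1 ≤ κ := by rw [hκ]; exact (one_le_div hμ).2 hμL
  have hlam : ∀ y, 0 ≤ lamG f y := fun y => Real.sqrt_nonneg _
  have hJH := Jmat_isHermitian (fun y => (hH y).isHermitian) x k
  have hcmp := Jmat_comparable hf hssc x k
  simp only [← hb] at hcmp
  have hJstep := Jmat_mulVec_step hf (fun y => (hH y).isHermitian) x k
  have hu : x (k + 1) - x k = -(G⁻¹ *ᵥ grad f (x k)) := by rw [hx]; abel
  have hr₀ : 0 ≤ M * znorm f (x k) (x (k + 1) - x k) := mul_nonneg hM (Real.sqrt_nonneg _)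
  have ha₁ := h.one_le
  have hb₁ : 1 ≤ b := by linarith
  have ha : a - 1 ≤ 9 / 128 := by nlinarith [h.le_one_add]
  have hr : M * znorm f (x k) (x (k + 1) - x k) ≤ 9 / 8 * (M * lamG f (x k)) := by
    have := znorm_newton_step_le (hH (x k)) h.posDef (by linarith) h.hess_le
    rw [← hu] at this
    have h₁ := mul_le_mul_of_nonneg_left this hM
    have h₂ := mul_le_mul_of_nonneg_right (show a ≤ 9 / 8 by linarith)
      (mul_nonneg hM (hlam (x k)))
    linarith
  have hbκ : κ * (b - 1) ≤ 9 / 128 := by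
    have := mul_le_mul_of_nonneg_left hr (by linarith : 0 ≤ κ)
    rw [hb]
    linarith [h.local_le]
  have hb' : b - 1 ≤ 9 / 128 := by nlinarith
  have hJpd : (Jmat f x k).PosDef := by
    refine .of_quad_ge (div_pos hμ (by linarith : 0 < b)) hJH fun v => ?_
    rw [div_mul_eq_mul_div, div_le_iff₀ (by linarith), mul_comm _ b]
    exact (hlow _ v).trans (hcmp v).1.2
  have hJG : ∀ v, v ⬝ᵥ Jmat f x k *ᵥ v ≤ a * b * (v ⬝ᵥ G *ᵥ v) := fun v => by
    have := mul_le_mul_of_nonneg_left (h.hess_le v) (by linarith : 0 ≤ b)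
    linarith [(hcmp v).1.1]
  have hpsd : ((a * b) • G - Jmat f x k).PosSemidef :=
    posSemidef_sub_of_quad_le hJH
      (h.posDef.posSemidef.smul (by positivity : (0 : ℝ) ≤ a * b)).isHermitian
      fun v => by rw [quad_smul]; exact hJG v
  have hGherm := (h.posDef.posSemidef.smul (by positivity : (0 : ℝ) ≤ a * b)).isHermitian
  have hGH := h.quad_le hκ hμ hL.le (mul_nonneg hM (hlam _)) (hlow (x k))
  have hinv : 1 / κ ≤ 1 := by rw [div_le_one] <;> linarith
  have hinv₀ : 0 < 1 / κ := by positivity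
  have hbinv : b ≤ 1 + 9 / 128 * (1 / κ) := by
    rw [mul_one_div, ← sub_le_iff_le_add', le_div_iff₀ (by linarith)]
    linarith
  set q := 1 - 1 / (2 * κ) with hq
  have hq' : q = 1 - 1 / 2 * (1 / κ) := by rw [hq]; field_simp
  have hm_b : q / b * b = q := div_mul_cancel₀ _ (by linarith)
  have hcontr : lamG f (x (k + 1)) ≤ q * lamG f (x k) := by
    rw [← hm_b]
    refine lamG_newton_step_le hJpd h.posDef (hH _) (hH _) (by linarith)
      (div_nonneg (by linarith) (by linarith)) ((div_lt_one (by linarith)).2 (by linarith))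
      (fun v => ?_) (fun v => ?_) (fun v => (hcmp v).1.2) (fun v => (hcmp v).2.1) ?_
    · refine (hJG v).trans (mul_le_mul_of_nonneg_right ?_ (h.posDef.posSemidef.quad_nonneg v))
      have : a * b - 1 ≤ q / b := by
        rw [le_div_iff₀ (by linarith)]
        have hab : a * b - 1 ≤ 1 / 4 := by nlinarith
        nlinarith
      linarith
    · have h₁ := mul_le_mul_of_nonneg_left (hcmp v).1.2 (by linarith : 0 ≤ 3 / 2 * κ)
      refine ((hGH v).trans h₁).trans ?_
      rw [← mul_assoc]
      refine mul_le_mul_of_nonneg_right ?_ (hJpd.posSemidef.quad_nonneg v)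
      have hpos : 0 < 1 - q / b := by
        rw [sub_pos, div_lt_one (by linarith)]; linarith
      rw [← one_div, le_div_iff₀ hpos]
      have : 3 / 2 * κ * b * (1 - q / b) = 3 / 2 * κ * (b - q) := by
        field_simp
      rw [this]
      have hbq : b - q ≤ 2 / 3 * (1 / κ) := by linarith
      calc 3 / 2 * κ * (b - q) ≤ 3 / 2 * κ * (2 / 3 * (1 / κ)) := by gcongr
        _ = 1 := by field_simp
    · rw [hu, mulVec_neg] at hJstep
      rw [sub_eq_add_neg, hJstep]
      abel
  have hl : M * lamG f (x (k + 1)) ≤ q * (M * lamG f (x k)) := by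
    have := mul_le_mul_of_nonneg_left hcontr hM
    linarith
  have hdec : M * lamG f (x k) ≤
      2 * κ * (M * lamG f (x k) - M * lamG f (x (k + 1))) := by
    have h₁ := mul_le_mul_of_nonneg_left hl (by linarith : 0 ≤ 2 * κ)
    have : 2 * κ * (q * (M * lamG f (x k))) = (2 * κ - 1) * (M * lamG f (x k)) := by
      rw [hq]; field_simp
    linarith
  refine ⟨hpsd, ?_, hb₁, hbκ, ?_, fun v => ?_, fun v => ?_⟩
  · refine .of_quad_ge (div_pos hμ (by linarith : 0 < b)) (SR1_isHermitian hGherm _) fun v => ?_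
    rw [div_mul_eq_mul_div, div_le_iff₀ (by linarith), mul_comm _ b]
    exact ((hlow _ v).trans (hcmp v).1.2).trans
      (mul_le_mul_of_nonneg_left (le_SR1_quad hpsd _ v) (by linarith))
  · have : M * lamG f (x (k + 1)) ≤ M * lamG f (x k) := by
      nlinarith [mul_nonneg hM (hlam (x k))]
    exact (mul_le_mul_of_nonneg_left this (by linarith)).trans h.local_le
  · exact (hcmp v).2.2.trans
      (mul_le_mul_of_nonneg_left (le_SR1_quad hpsd _ v) (by linarith))
  · have hv : 0 ≤ v ⬝ᵥ v := by simpa using dotProduct_star_self_nonneg v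
    have h₁ := SR1_quad_le hpsd (x (k + 1) - x k) v
    rw [quad_smul] at h₁
    have hexp : b ^ 2 * Real.exp (9 / 32 - 9 / 4 * (κ * (M * lamG f (x k)))) ≤
        Real.exp (9 / 32 - 9 / 4 * (κ * (M * lamG f (x (k + 1))))) := by
      have hbe : b ≤ Real.exp (b - 1) := by linarith [Real.add_one_le_exp (b - 1)]
      calc _ ≤ Real.exp (b - 1) ^ 2 * Real.exp (9 / 32 - 9 / 4 * (κ * (M * lamG f (x k)))) := by
            gcongr
        _ = Real.exp (2 * (b - 1) + (9 / 32 - 9 / 4 * (κ * (M * lamG f (x k))))) := by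
            rw [Real.exp_add, ← Real.exp_nat_mul]; norm_num
        _ ≤ _ := Real.exp_le_exp.2 (by rw [hb]; linarith)
    calc _ ≤ b * (a * b * (v ⬝ᵥ G *ᵥ v)) := by gcongr
      _ = b ^ 2 * (a * (v ⬝ᵥ G *ᵥ v)) := by ring
      _ ≤ b ^ 2 * (Real.exp (9 / 32 - 9 / 4 * (κ * (M * lamG f (x k)))) * L * (v ⬝ᵥ v)) :=
          mul_le_mul_of_nonneg_left (h.le_smul_one v) (sq_nonneg b)
      _ = b ^ 2 * Real.exp (9 / 32 - 9 / 4 * (κ * (M * lamG f (x k)))) * (L * (v ⬝ᵥ v)) := by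
          ring
      _ ≤ Real.exp (9 / 32 - 9 / 4 * (κ * (M * lamG f (x (k + 1))))) * (L * (v ⬝ᵥ v)) := by gcongr
      _ = _ := by ring

end Iteration

/-- Corollary 4.1: along the SR1_CS iteration started with
`Mλ_f(x₀) ≤ ln(3/2)/(4κ)`, one has `J_k ⪯ G̃_k` and `G_k ⪯ 3κ ∇²f(x_k)`,
where `G̃_k = (1 + M r_{k−1}/2)(1 + M r_k/2) G_k`. -/
theorem sr1_cs_correction_valid
    {n : ℕ} (f : (Fin n → ℝ) → ℝ) (μ L M : ℝ)
    (hf : ContDiff ℝ 2 f) (hμ : 0 < μ) (hμL : μ ≤ L) (hM : 0 ≤ M)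
    (hlow : ∀ y : Fin n → ℝ, (hess f y - μ • (1 : Matrix (Fin n) (Fin n) ℝ)).PosSemidef)
    (hup : ∀ y : Fin n → ℝ, (L • (1 : Matrix (Fin n) (Fin n) ℝ) - hess f y).PosSemidef)
    (hssc : StrongSelfConcordant f M)
    (x : ℕ → Fin n → ℝ) (G : ℕ → Matrix (Fin n) (Fin n) ℝ) (r rm : ℕ → ℝ)
    (hG0 : G 0 = L • (1 : Matrix (Fin n) (Fin n) ℝ))
    (hrm0 : rm 0 = 0) (hrmS : ∀ k, rm (k+1) = r k)
    (hx : ∀ k, x (k+1) = x k - (G k)⁻¹ *ᵥ grad f (x k))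
    (hr : ∀ k, r k = znorm f (x k) (x (k+1) - x k))
    (hGS : ∀ k, G (k+1) =
      SR1 (Jmat f x k) (((1 + M * rm k / 2) * (1 + M * r k / 2)) • G k) (x (k+1) - x k))
    (hloc : M * lamG f (x 0) ≤ Real.log (3 / 2) / (4 * (L / μ))) :
    ∀ k : ℕ,
      ((((1 + M * rm k / 2) * (1 + M * r k / 2)) • G k) - Jmat f x k).PosSemidef ∧
      ((3 * (L / μ)) • hess f (x k) - G k).PosSemidef := by
  have hL : 0 < L := hμ.trans_le hμL
  have hκ₀ : 0 < L / μ := div_pos hL hμ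
  have hq : ∀ y v : Fin n → ℝ, μ * (v ⬝ᵥ v) ≤ v ⬝ᵥ hess f y *ᵥ v := fun y v => by
    simpa [quad_smul] using (hlow y).quad_le v
  have hherm : ∀ y, (hess f y).IsHermitian := fun y => by
    have := (hlow y).isHermitian.add
      ((PosSemidef.one (n := Fin n) (R := ℝ)).smul hμ.le).isHermitian
    rwa [sub_add_cancel] at this
  have hH : ∀ y, (hess f y).PosDef := fun y => .of_quad_ge hμ (hherm y) (hq y)
  have hstate : ∀ k, CorrectedState (L / μ) L (1 + M * rm k / 2) (M * lamG f (x k))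
      (hess f (x k)) (G k) := by
    intro k
    induction k with
    | zero =>
      have hl : L / μ * (M * lamG f (x 0)) ≤ 1 / 8 := by
        have hlog := Real.log_le_sub_one_of_pos (show (0 : ℝ) < 3 / 2 by norm_num)
        rw [le_div_iff₀ (by positivity)] at hloc
        linarith
      simp only [hrm0, hG0]
      refine ⟨PosDef.one.smul hL, by simp, by norm_num, hl, fun v => ?_, fun v => ?_⟩
      · simpa using (hup (x 0)).quad_le v
      · have hv : 0 ≤ v ⬝ᵥ v := by simpa using dotProduct_star_self_nonneg v
        rw [quad_smul, one_mulVec, mul_zero, zero_div, add_zero, one_mul, mul_assoc]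
        exact le_mul_of_one_le_left (by positivity) (Real.one_le_exp (by linarith))
    | succ k ih =>
      have := (ih.step rfl hf hμ hμL hM hH hq hssc (hx k) rfl).2
      rwa [← hr, ← hGS, ← hrmS] at this
  intro k
  have hk := hstate k
  refine ⟨?_, posSemidef_sub_of_quad_le hk.posDef.isHermitian
    ((hH _).posSemidef.smul (by positivity : (0 : ℝ) ≤ 3 * (L / μ))).isHermitian fun v => ?_⟩
  · have := (hk.step rfl hf hμ hμL hM hH hq hssc (hx k) rfl).1
    rwa [← hr] at this
  · have h₁ := hk.quad_le rfl hμ hL.le (mul_nonneg hM (Real.sqrt_nonneg _)) (hq _) v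
    have h₂ := mul_nonneg hκ₀.le ((hH (x k)).posSemidef.quad_nonneg v)
    rw [quad_smul]
    linarith
end
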